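/- arXiv:2506.18207 — 3 statements merged into one kernel-verified Lean document; each statement's English description precedes it below -/
import Mathlib

section
/- Neo-classical inequality: for every natural number m and every real p ≥ 1, one has Σ_{i=0}^{m} 1/((i/p)! · ((m−i)/p)!) ≤ p · 2^{m/p} / (m/p)!, where x! denotes Γ(x+1). -/
open Real Filter Topology MeasureTheory

noncomputable def nK (c s : ℝ) : ℝ := ∫ θ in (-(π/2))..(π/2), cos θ ^ s * cos (c*θ)
noncomputable def nG (c s : ℝ) : ℝ :=
  Gamma (s+1) * (Gamma ((s-c)/2+1))⁻¹ * (Gamma ((s+c)/2+1))⁻¹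
noncomputable def nF (c s : ℝ) : ℝ := 2^s / π * nK c s

lemma nK_rec (c s : ℝ) (hs : 0 ≤ s) :
    ((s+2)^2 - c^2) * nK c (s+2) = (s+2)*(s+1) * nK c s := by
  have hcont : ∀ r : ℝ, 0 ≤ r → Continuous (fun θ : ℝ => cos θ ^ r * cos (c*θ)) := by
    intro r hr
    exact (continuous_cos.rpow_const (fun _ => Or.inr hr)).mul (by fun_prop)
  have key : ∫ θ in (-(π/2))..(π/2), ((s+2)*(s+1) * (cos θ ^ s * cos (c*θ))
      - ((s+2)^2 - c^2) * (cos θ ^ (s+2) * cos (c*θ))) = 0 := by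
    have hd : ∀ θ ∈ Set.uIcc (-(π/2)) (π/2), HasDerivAt
        (fun θ => -(s+2) * (cos θ ^ (s+1) * sin θ * cos (c*θ)) + c * (cos θ ^ (s+2) * sin (c*θ)))
        ((s+2)*(s+1) * (cos θ ^ s * cos (c*θ))
      - ((s+2)^2 - c^2) * (cos θ ^ (s+2) * cos (c*θ))) θ := by
      intro θ hθ
      rw [Set.uIcc_of_le (by linarith [pi_pos])] at hθ
      have hc0 : 0 ≤ cos θ := cos_nonneg_of_mem_Icc hθ
      have h1 := (hasDerivAt_cos θ).rpow_const (p := s+1) (Or.inr (by linarith))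
      have h2 := (hasDerivAt_cos θ).rpow_const (p := s+2) (Or.inr (by linarith))
      have hl : HasDerivAt (fun θ : ℝ => c * θ) c θ := by
        simpa using (hasDerivAt_id θ).const_mul c
      have h3 := (hasDerivAt_sin (c*θ)).comp θ hl
      have h4 := (hasDerivAt_cos (c*θ)).comp θ hl
      have h := (((h1.mul (hasDerivAt_sin θ)).mul h4).const_mul (-(s+2))).add
        ((h2.mul h3).const_mul c)
      refine h.congr_deriv ?_
      simp only [Function.comp_apply]
      rw [show s+2-1 = s+1 by ring, show s+1-1 = s by ring]
      have e1 : cos θ ^ (s+1) = cos θ ^ s * cos θ := by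
        rw [rpow_add_one' hc0 (by linarith)]
      have e2 : cos θ ^ (s+2) = cos θ ^ s * cos θ^2 := by
        rw [show s+2 = s+1+1 by ring, rpow_add_one' hc0 (by linarith), e1]; ring
      simp only [Pi.mul_apply]
      rw [e1, e2]
      have := sin_sq_add_cos_sq θ
      have h5 : sin θ ^ 2 = 1 - cos θ ^2 := by linarith
      ring_nf
      rw [h5]
      ring
    rw [intervalIntegral.integral_eq_sub_of_hasDerivAt hd]
    · simp only [cos_neg, cos_pi_div_two]
      rw [zero_rpow (by linarith), zero_rpow (by linarith)]; simp
    · apply Continuous.intervalIntegrable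
      exact ((hcont s hs).const_mul _ ).sub ((hcont (s+2) (by linarith)).const_mul _)
  rw [intervalIntegral.integral_sub, intervalIntegral.integral_const_mul,
    intervalIntegral.integral_const_mul] at key
  · unfold nK; linarith
  · exact ((hcont s hs).const_mul _ ).intervalIntegrable _ _
  · exact ((hcont (s+2) (by linarith)).const_mul _ ).intervalIntegrable _ _

lemma inv_Gamma_rec (x : ℝ) : (Gamma x)⁻¹ = x * (Gamma (x+1))⁻¹ := by
  rcases ne_or_eq x 0 with (h | rfl)
  · rw [Gamma_add_one h, mul_inv, mul_inv_cancel_left₀ h]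
  · rw [zero_add, Gamma_zero, inv_zero, zero_mul]

lemma nG_rec (c s : ℝ) (hs : 0 ≤ s) :
    ((s+2)^2 - c^2)/4 * nG c (s+2) = (s+2)*(s+1) * nG c s := by
  unfold nG
  rw [inv_Gamma_rec ((s-c)/2+1), inv_Gamma_rec ((s+c)/2+1),
    show s+2+1 = (s+1+1)+1 by ring, Gamma_add_one (s := s+1+1) (by linarith),
    Gamma_add_one (s := s+1) (by linarith), show (s+2-c)/2+1 = (s-c)/2+1+1 by ring,
    show (s+2+c)/2+1 = (s+c)/2+1+1 by ring]
  ring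

lemma nF_rec (c s : ℝ) (hs : 0 ≤ s) :
    ((s+2)^2 - c^2)/4 * nF c (s+2) = (s+2)*(s+1) * nF c s := by
  unfold nF
  have := nK_rec c s hs
  rw [rpow_add (by norm_num), show (2:ℝ)^(2:ℝ) = 4 by norm_num]
  linear_combination 2^s/π * this

lemma nFG_zero (N : ℕ) : nF 0 (2*N) = nG 0 (2*N) := by
  induction N with
  | zero => simp [nF, nG, nK]
  | succ N ih =>
    have h1 := nF_rec 0 (2*N) (by positivity)
    have h2 := nG_rec 0 (2*N) (by positivity)
    rw [ih, ← h2] at h1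
    have : ((2*N+2:ℝ)^2-0^2)/4 ≠ 0 := by ring_nf; positivity
    have h3 := mul_left_cancel₀ this h1
    push_cast
    rw [show (2*(N+1):ℝ) = 2*N+2 by ring]; exact h3

lemma nFG_prop (c s : ℝ) (hs : 0 ≤ s) (hc : c^2 < (s+2)^2) (N : ℕ) :
    nF c (s+2*N) * nG c s = nG c (s+2*N) * nF c s := by
  induction N with
  | zero => simp; ring
  | succ N ih =>
    have h1 := nF_rec c (s+2*N) (by positivity)
    have h2 := nG_rec c (s+2*N) (by positivity)
    have : ((s+2*N+2:ℝ)^2-c^2)/4 ≠ 0 := by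
      have : (s+2)^2 ≤ (s+2*N+2)^2 := by
        gcongr; linarith [(Nat.cast_nonneg N : (0:ℝ) ≤ N)]
      have : 0 < (s+2*N+2:ℝ)^2-c^2 := by linarith
      positivity
    push_cast
    rw [show (s+2*(N+1):ℝ) = s+2*N+2 by ring]
    apply mul_left_cancel₀ this
    linear_combination nG c s * h1 - nF c s * h2 + (s+2*N+2)*(s+2*N+1) * ih

lemma nF_ratio (c s : ℝ) (hs : 0 ≤ s) :
    Tendsto (fun N : ℕ => (nF 0 (2*N))⁻¹ * nF c (s+2*N)) atTop (𝓝 (2^s)) := by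
  have h := tendsto_setIntegral_pow_smul_of_unique_maximum_of_isCompact_of_continuousOn
    (μ := volume) (s := Set.Icc (-(π/2)) (π/2)) (x₀ := 0) (c := fun θ => cos θ ^ 2)
    (g := fun θ : ℝ => cos θ ^ s * cos (c*θ)) isCompact_Icc (by fun_prop) ?_ ?_ ?_ ?_ ?_
  · simp only [cos_zero, one_rpow, mul_zero, mul_one] at h
    have h' := h.const_mul (2^s)
    rw [mul_one] at h'
    refine h'.congr ?_
    intro N
    have e1 : nK 0 (2*N) = ∫ x in Set.Icc (-(π/2)) (π/2), (cos x ^ 2)^N := by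
      unfold nK
      rw [intervalIntegral.integral_of_le (by linarith [pi_pos]), integral_Icc_eq_integral_Ioc]
      refine setIntegral_congr_fun measurableSet_Ioc ?_
      intro x hx
      simp only [zero_mul, cos_zero, mul_one]
      rw [← pow_mul]; exact_mod_cast rpow_natCast (cos x) (2*N)
    have e2 : nK c (s+2*N) = ∫ x in Set.Icc (-(π/2)) (π/2), (cos x ^ 2)^N • (cos x ^ s * cos (c*x)) := by
      unfold nK
      rw [intervalIntegral.integral_of_le (by linarith [pi_pos]), integral_Icc_eq_integral_Ioc,
        integral_Ioc_eq_integral_Ioo, integral_Ioc_eq_integral_Ioo]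
      refine setIntegral_congr_fun measurableSet_Ioo ?_
      intro x hx
      have : 0 < cos x := cos_pos_of_mem_Ioo hx
      simp only [smul_eq_mul]
      rw [rpow_add this, ← pow_mul]
      have : cos x ^ (2*N:ℝ) = cos x ^ (2*N) := by exact_mod_cast rpow_natCast (cos x) (2*N)
      rw [this]; ring
    rw [nF, nF, e1, e2, rpow_add (by norm_num), smul_eq_mul]
    have : (2:ℝ)^(2*N:ℝ) ≠ 0 := by positivity
    have := pi_ne_zero
    field_simp
  · intro y hy hy0
    have hy1 : 0 ≤ cos y := cos_nonneg_of_mem_Icc hy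
    simp only [cos_zero, one_pow]
    have h2 : sin y ≠ 0 := by
      intro h
      rw [sin_eq_zero_iff_of_lt_of_lt (by linarith [hy.1, pi_pos]) (by linarith [hy.2, pi_pos])] at h
      exact hy0 h
    have := sin_sq_add_cos_sq y
    have : 0 < sin y ^2 := by positivity
    linarith
  · intro x _; positivity
  · simp
  · rw [interior_Icc]; apply subset_closure; constructor <;> linarith [pi_pos]
  · exact ((continuous_cos.rpow_const (fun _ => Or.inr hs)).mul (by fun_prop)).continuousOn

lemma Gamma_asymp (a : ℝ) (ha : 0 < a) :
    Tendsto (fun N : ℕ => (N:ℝ)^a * Gamma (N+1) / Gamma (a+N+1)) atTop (𝓝 1) := by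
  have h := (GammaSeq_tendsto_Gamma a).div_const (Gamma a)
  have hG := (Gamma_pos_of_pos ha).ne'
  rw [div_self hG] at h
  refine h.congr fun N => ?_
  have : ∀ n : ℕ, Gamma (a+n) = (∏ j ∈ Finset.range n, (a+j)) * Gamma a := by
    intro n
    induction n with
    | zero => simp
    | succ n ih =>
      rw [Finset.prod_range_succ]; push_cast
      rw [← add_assoc, Gamma_add_one (by positivity), ih]; ring
  have h2 := this (N+1)
  push_cast at h2
  rw [GammaSeq, Gamma_nat_eq_factorial, add_assoc, h2, div_div]

lemma nG_ratio (c s : ℝ) (hs : 0 < s) (h1 : 0 < s - c) (h2 : 0 < s + c) :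
    Tendsto (fun N : ℕ => (nG 0 (2*N))⁻¹ * nG c (s+2*N)) atTop (𝓝 (2^s)) := by
  have hx := Gamma_asymp ((s-c)/2) (by linarith)
  have hy := Gamma_asymp ((s+c)/2) (by linarith)
  have h2N : Tendsto (fun N : ℕ => 2*N) atTop atTop :=
    tendsto_id.const_mul_atTop' (by norm_num)
  have hz := (Gamma_asymp s hs).comp h2N
  have h := (((hx.mul hy).div hz one_ne_zero).const_mul (2^s))
  simp only [mul_one, div_one] at h
  refine h.congr' ?_
  filter_upwards [eventually_gt_atTop 0] with N hN
  have hN' : (0:ℝ) < N := by exact_mod_cast hN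
  simp only [Pi.div_apply, Function.comp_apply, nG]
  push_cast
  rw [show (2*N-0:ℝ)/2+1 = N+1 by ring, show (2*N+0:ℝ)/2+1 = N+1 by ring,
   show (s+2*N-c)/2+1 = (s-c)/2+N+1 by ring, show (s+2*N+c)/2+1 = (s+c)/2+N+1 by ring,
   mul_rpow (by norm_num) hN'.le]
  have e : (N:ℝ)^s = (N:ℝ)^((s-c)/2) * (N:ℝ)^((s+c)/2) := by
    rw [← rpow_add hN']; ring_nf
  rw [e]
  have := (Gamma_pos_of_pos (show (0:ℝ) < 2*N+1 by positivity)).ne'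
  have := (Gamma_pos_of_pos (show (0:ℝ) < N+1 by positivity)).ne'
  have := (Gamma_pos_of_pos (show (0:ℝ) < s+2*N+1 by positivity)).ne'
  have := (Gamma_pos_of_pos (show (0:ℝ) < (s-c)/2+N+1 by positivity)).ne'
  have := (Gamma_pos_of_pos (show (0:ℝ) < (s+c)/2+N+1 by positivity)).ne'
  have : (N:ℝ)^((s-c)/2) ≠ 0 := by positivity
  have : (N:ℝ)^((s+c)/2) ≠ 0 := by positivity
  have : (2:ℝ)^s ≠ 0 := by positivity
  field_simp

lemma nFG_big (c s : ℝ) (hs : 0 < s) (h1 : 0 < s - c) (h2 : 0 < s + c) : nF c s = nG c s := by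
  have hF := (nF_ratio c s hs.le).mul_const (nG c s)
  have hG := (nG_ratio c s hs h1 h2).mul_const (nF c s)
  have hc : c^2 < (s+2)^2 := by nlinarith
  have := tendsto_nhds_unique (hF.congr fun N => by
    rw [mul_assoc, nFG_prop c s hs.le hc, ← mul_assoc, nFG_zero]) hG
  exact (mul_left_cancel₀ (by positivity) this).symm

lemma nFG (c s : ℝ) (hs : 0 < s) : nF c s = nG c s := by
  have key : ∀ N : ℕ, ∀ s : ℝ, 0 < s → |c| < s + 2*N → nF c s = nG c s := by
    intro N
    induction N with
    | zero =>
      intro s hs h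
      have := abs_lt.1 h
      norm_num at this
      exact nFG_big c s hs (by linarith) (by linarith)
    | succ N ih =>
      intro s hs h
      have h0 := ih (s+2) (by linarith) (by push_cast at h; linarith)
      have h1 := nF_rec c s hs.le
      have h2 := nG_rec c s hs.le
      rw [h0, h2] at h1
      exact (mul_left_cancel₀ (by positivity) h1).symm
  obtain ⟨N, hN⟩ := exists_nat_gt |c|
  exact key N s hs (by linarith [(Nat.cast_nonneg N : (0:ℝ) ≤ N)])
lemma nK_complex (c s : ℝ) (hs : 0 ≤ s) :
    ∫ θ in (-(π/2))..(π/2), ((cos θ ^ s : ℝ) : ℂ) * Complex.exp (Complex.I * (c*θ : ℝ)) =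
      (nK c s : ℂ) := by
  have h1 : Continuous (fun θ : ℝ => cos θ ^ s * cos (c*θ)) :=
    (continuous_cos.rpow_const (fun _ => Or.inr hs)).mul (by fun_prop)
  have h2 : Continuous (fun θ : ℝ => cos θ ^ s * sin (c*θ)) :=
    (continuous_cos.rpow_const (fun _ => Or.inr hs)).mul (by fun_prop)
  have e : ∀ θ : ℝ, ((cos θ ^ s : ℝ) : ℂ) * Complex.exp (Complex.I * (c*θ : ℝ)) =
      ((cos θ ^ s * cos (c*θ) : ℝ) : ℂ) + ((cos θ ^ s * sin (c*θ) : ℝ) : ℂ) * Complex.I := by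
    intro θ
    rw [mul_comm Complex.I, Complex.exp_mul_I, ← Complex.ofReal_cos, ← Complex.ofReal_sin]
    push_cast; ring
  simp_rw [e]
  rw [intervalIntegral.integral_add, intervalIntegral.integral_mul_const,
    intervalIntegral.integral_ofReal, intervalIntegral.integral_ofReal]
  · have : ∫ θ in (-(π/2))..(π/2), cos θ ^ s * sin (c*θ) = 0 := by
      have h := intervalIntegral.integral_comp_neg (a := -(π/2)) (b := π/2)
        (fun θ => cos θ ^ s * sin (c*θ))
      simp only [cos_neg, mul_neg, sin_neg, neg_neg, intervalIntegral.integral_neg] at h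
      linarith
    rw [this]; simp [nK]
  · exact (Complex.continuous_ofReal.comp h1).intervalIntegrable _ _
  · exact ((Complex.continuous_ofReal.comp h2).mul continuous_const).intervalIntegrable _ _

noncomputable def ng (s t : ℝ) : ℂ :=
  (((2 * cos (min |t| π / 2)) ^ s : ℝ) : ℂ) * Complex.exp (Complex.I * (s/2*t : ℝ))

lemma ng_continuous (s : ℝ) (hs : 0 ≤ s) : Continuous (ng s) := by
  unfold ng
  refine (Complex.continuous_ofReal.comp (Continuous.rpow_const (by fun_prop)
    (fun _ => Or.inr hs))).mul (by fun_prop)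

lemma ng_zero_of (s t : ℝ) (hs : 0 < s) (ht : π ≤ |t|) : ng s t = 0 := by
  unfold ng
  rw [min_eq_right ht, cos_pi_div_two, mul_zero, zero_rpow hs.ne']; simp

lemma ng_integral (s d : ℝ) (hs : 0 < s) (L : ℝ) (hL : π ≤ L) :
    ∫ t in (-L)..L, Complex.exp (Complex.I * (-(d*t) : ℝ)) * ng s t
      = ((2 * π * nF (s - 2*d) s : ℝ) : ℂ) := by
  have hc : Continuous (fun t : ℝ => Complex.exp (Complex.I * (-(d*t) : ℝ)) * ng s t) :=
    Continuous.mul (by fun_prop) (ng_continuous s hs.le)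
  have hpi := pi_pos
  rw [← intervalIntegral.integral_add_adjacent_intervals (b := -π) (hc.intervalIntegrable _ _)
      (hc.intervalIntegrable _ _),
    ← intervalIntegral.integral_add_adjacent_intervals (a := -π) (b := π)
      (hc.intervalIntegrable _ _) (hc.intervalIntegrable _ _)]
  have z1 : ∫ t in (-L)..(-π), Complex.exp (Complex.I * (-(d*t) : ℝ)) * ng s t = 0 := by
    rw [intervalIntegral.integral_congr (g := fun _ => 0)]
    · simp
    · intro t ht
      rw [Set.uIcc_of_le (by linarith)] at ht
      simp only
      rw [ng_zero_of s t hs, mul_zero]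
      rw [le_abs]; right; linarith [ht.2]
  have z2 : ∫ t in π..L, Complex.exp (Complex.I * (-(d*t) : ℝ)) * ng s t = 0 := by
    rw [intervalIntegral.integral_congr (g := fun _ => 0)]
    · simp
    · intro t ht
      rw [Set.uIcc_of_le (by linarith)] at ht
      simp only
      rw [ng_zero_of s t hs, mul_zero]
      rw [le_abs]; left; linarith [ht.1]
  rw [z1, z2, zero_add, add_zero]
  have h := intervalIntegral.smul_integral_comp_mul_left (a := -(π/2)) (b := π/2)
    (fun t : ℝ => Complex.exp (Complex.I * (-(d*t) : ℝ)) * ng s t) 2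
  rw [show 2 * -(π/2) = -π by ring, show 2 * (π/2) = π by ring] at h
  rw [← h]
  have h3 : ∫ x in (-(π/2))..(π/2), Complex.exp (Complex.I * (-(d*(2*x)) : ℝ)) * ng s (2*x) =
      ∫ x in (-(π/2))..(π/2), ((2^s : ℝ) : ℂ) * (((cos x ^ s : ℝ) : ℂ) *
        Complex.exp (Complex.I * ((s-2*d)*x : ℝ))) := by
    apply intervalIntegral.integral_congr
    intro x hx
    rw [Set.uIcc_of_le (by linarith)] at hx
    have hc0 : 0 ≤ cos x := cos_nonneg_of_mem_Icc hx
    have habs : |2*x| ≤ π := abs_le.2 ⟨by linarith [hx.1], by linarith [hx.2]⟩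
    simp only [ng]
    rw [min_eq_left habs]
    have : cos (|2*x|/2) = cos x := by
      rw [abs_mul, abs_two, mul_div_cancel_left₀ _ two_ne_zero, cos_abs]
    rw [this, mul_rpow (by norm_num) hc0, mul_left_comm, ← Complex.exp_add, Complex.ofReal_mul,
      mul_assoc]
    congr 4
    push_cast; ring
  rw [h3, intervalIntegral.integral_const_mul, nK_complex _ _ hs.le]
  simp only [nF, Complex.real_smul]
  push_cast
  have : (π:ℂ) ≠ 0 := by exact_mod_cast hpi.ne'
  field_simp

lemma fourier_sum (s α : ℝ) (hs : 0 < s) (hα : 0 < α) (hα1 : α ≤ 1)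
    (hsum : Summable (fun j : ℤ => nF (s - 2*(α*j)) s)) :
    HasSum (fun j : ℤ => α * nF (s - 2*(α*j)) s) (2^s) := by
  have hpi := pi_pos
  set L : ℝ := π/α with hLdef
  have hL : π ≤ L := by rw [hLdef, le_div_iff₀ hα]; nlinarith
  have hLpos : 0 < L := by linarith
  have : Fact (0 < 2*L) := ⟨by linarith⟩
  let g : C(AddCircle (2*L), ℂ) := ⟨AddCircle.liftIco (2*L) (-L) (ng s),
    AddCircle.liftIco_continuous (by
      rw [ng_zero_of s _ hs (by rw [abs_neg, abs_of_pos hLpos]; exact hL),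
        ng_zero_of s _ hs (by rw [show -L+2*L = L by ring, abs_of_pos hLpos]; exact hL)])
      (ng_continuous s hs.le).continuousOn⟩
  have hcoef : ∀ j : ℤ, fourierCoeff g j = ((α * nF (s - 2*(α*j)) s : ℝ) : ℂ) := by
    intro j
    have h := fourierCoeff_eq_intervalIntegral (T := 2*L) (g : AddCircle (2*L) → ℂ) j (-L)
    rw [h]
    have : ∫ x in (-L)..(-L+2*L), fourier (-j) (x : AddCircle (2*L)) • g x =
       ∫ t in (-L)..L, Complex.exp (Complex.I * (-((α*j)*t) : ℝ)) * ng s t := by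
      rw [show -L+2*L = L by ring]
      refine intervalIntegral.integral_congr_Ioo_of_le (by linarith) fun x hx => ?_
      have : g x = ng s x := by
        change AddCircle.liftIco (2*L) (-L) (ng s) x = _
        rw [AddCircle.liftIco_coe_apply]
        exact ⟨hx.1.le, by linarith [hx.2]⟩
      rw [this, smul_eq_mul, fourier_coe_apply]
      congr 2
      rw [hLdef]; push_cast
      have : (π:ℂ) ≠ 0 := by exact_mod_cast hpi.ne'
      have : (α:ℂ) ≠ 0 := by exact_mod_cast hα.ne'
      field_simp
    rw [this, ng_integral s _ hs L hL, Complex.real_smul]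
    rw [hLdef]; push_cast
    have : (π:ℂ) ≠ 0 := by exact_mod_cast hpi.ne'
    have : (α:ℂ) ≠ 0 := by exact_mod_cast hα.ne'
    field_simp
  have hs' : Summable (fourierCoeff g) := by
    rw [show fourierCoeff g = fun j : ℤ => ((α * nF (s - 2*(α*j)) s : ℝ) : ℂ) from funext hcoef]
    exact Complex.ofRealCLM.summable (hsum.mul_left α)
  have := has_pointwise_sum_fourier_series_of_summable hs' ((0:ℝ) : AddCircle (2*L))
  have hg0 : g ((0:ℝ) : AddCircle (2*L)) = ((2^s : ℝ) : ℂ) := by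
    change AddCircle.liftIco (2*L) (-L) (ng s) ((0:ℝ) : AddCircle (2*L)) = _
    rw [AddCircle.liftIco_coe_apply ⟨by linarith, by linarith⟩]
    simp [ng, hpi.le]
  rw [hg0] at this
  simp only [hcoef, fourier_coe_apply] at this
  rw [← Complex.hasSum_ofReal]
  simpa using this

lemma beta_real (x y : ℝ) (hx : 0 < x) (hy : 0 < y) :
    IntegrableOn (fun t : ℝ => t^(x-1) * (1-t)^(y-1)) (Set.Ioo 0 1) ∧
    ∫ t in Set.Ioo (0:ℝ) 1, t^(x-1) * (1-t)^(y-1) = Gamma x * Gamma y / Gamma (x+y) := by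
  have hconv := Complex.betaIntegral_convergent (u := x) (v := y) (by simpa) (by simpa)
  have e : Set.EqOn (fun t : ℝ => (t:ℂ)^((x:ℂ)-1) * (1-(t:ℂ))^((y:ℂ)-1))
     (fun t : ℝ => ((t^(x-1) * (1-t)^(y-1) : ℝ) : ℂ)) (Set.Ioo 0 1) := by
    intro t ht
    simp only
    rw [Complex.ofReal_mul, Complex.ofReal_cpow ht.1.le, Complex.ofReal_cpow (by linarith [ht.2])]
    push_cast; rfl
  constructor
  · rw [intervalIntegrable_iff_integrableOn_Ioo_of_le zero_le_one] at hconv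
    have h := (hconv.congr_fun e measurableSet_Ioo).re
    unfold IntegrableOn
    simpa using h
  · have h := Complex.betaIntegral_eq_Gamma_mul_div x y (by simpa) (by simpa)
    rw [Complex.betaIntegral, intervalIntegral.integral_of_le zero_le_one,
      integral_Ioc_eq_integral_Ioo, setIntegral_congr_fun measurableSet_Ioo e,
      integral_complex_ofReal, ← Complex.ofReal_add, Complex.Gamma_ofReal, Complex.Gamma_ofReal,
      Complex.Gamma_ofReal] at h
    exact_mod_cast h

noncomputable def nB (x y : ℝ) : ℝ := ∫ t in Set.Ioo (0:ℝ) 1, t^(x-1) * (1-t)^(y-1)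

lemma nB_nonneg (x y : ℝ) : 0 ≤ nB x y := by
  refine setIntegral_nonneg measurableSet_Ioo fun t ht => ?_
  have := ht.1.le
  have : 0 ≤ 1 - t := by linarith [ht.2]
  positivity

lemma nB_step (x s α : ℝ) (hx : 0 < x) (hs : 0 < s) (hα : 0 < α) (hα1 : α ≤ 1) :
    α * nB x (s+1) ≤ nB x s - nB (x+α) s := by
  unfold nB
  rw [← integral_const_mul, ← integral_sub (beta_real x s hx hs).1
    (beta_real (x+α) s (by linarith) hs).1]
  refine setIntegral_mono_on ((beta_real x (s+1) hx (by linarith)).1.const_mul α)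
    ((beta_real x s hx hs).1.sub (beta_real (x+α) s (by linarith) hs).1) measurableSet_Ioo ?_
  intro t ht
  have h0 := ht.1
  have h1 : 0 < 1 - t := by linarith [ht.2]
  have hb : t^α ≤ 1 + α * (t-1) := by
    have := rpow_one_add_le_one_add_mul_self (s := t-1) (by linarith) hα.le hα1
    simpa using this
  rw [show x + α - 1 = (x-1) + α by ring, rpow_add h0, show s+1-1 = (s-1)+1 by ring,
    rpow_add_one h1.ne']
  have hp : 0 ≤ t^(x-1) * (1-t)^(s-1) := by positivity
  nlinarith

lemma nB_summable (s α : ℝ) (hs : 0 < s) (hα : 0 < α) (hα1 : α ≤ 1) :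
    Summable (fun k : ℕ => nB (α*(k+1)) (s+1)) := by
  refine summable_of_sum_range_le (c := nB α s / α) (fun _ => nB_nonneg _ _) ?_
  intro n
  have : α * ∑ i ∈ Finset.range n, nB (α*(i+1)) (s+1) ≤ nB α s - nB (α*(n+1)) s := by
    induction n with
    | zero => simp
    | succ n ih =>
      rw [Finset.sum_range_succ, mul_add]
      have := nB_step (α*(n+1)) s α (by positivity) hs hα hα1
      push_cast
      rw [show α*((n:ℝ)+1+1) = α*(n+1)+α by ring]
      linarith
  rw [le_div_iff₀ hα]
  linarith [nB_nonneg (α*(n+1)) s]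

lemma sin_sum_nonneg (φ r : ℝ) (h0 : 0 ≤ φ) (h1 : φ ≤ π) (hr : 0 < r) (hr1 : r < 1) :
    0 ≤ ∑' k : ℕ, sin (φ*(k+1)) * r^(k+1) := by
  set z : ℂ := r * Complex.exp (φ * Complex.I) with hz
  have hnorm : ‖z‖ < 1 := by
    rw [hz, norm_mul, Complex.norm_exp_ofReal_mul_I, mul_one, Complex.norm_real, norm_of_nonneg hr.le]
    exact hr1
  have h := (hasSum_geometric_of_norm_lt_one hnorm).mul_left z
  have h2 := Complex.imCLM.hasSum h
  have e : ∀ k : ℕ, Complex.imCLM (z * z^k) = sin (φ*(k+1)) * r^(k+1) := by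
    intro k
    rw [← pow_succ', hz, mul_pow, ← Complex.exp_nat_mul, ← Complex.ofReal_pow,
      show ((k+1:ℕ):ℂ) * (φ * Complex.I) = ((φ*(k+1) : ℝ) : ℂ) * Complex.I by push_cast; ring]
    simp only [Complex.imCLM_apply, Complex.im_ofReal_mul, Complex.exp_ofReal_mul_I_im]
    ring
  have h3 : HasSum (fun k : ℕ => sin (φ*(k+1)) * r^(k+1)) (Complex.imCLM (z * (1-z)⁻¹)) := by
    simpa only [e] using h2
  rw [h3.tsum_eq, Complex.imCLM_apply]
  have him : 0 ≤ z.im := by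
    rw [hz, Complex.im_ofReal_mul, Complex.exp_ofReal_mul_I_im]
    exact mul_nonneg hr.le (sin_nonneg_of_nonneg_of_le_pi h0 h1)
  have : (z * (1-z)⁻¹).im = z.im / Complex.normSq (1-z) := by
    rw [Complex.mul_im, Complex.inv_re, Complex.inv_im]
    simp only [Complex.sub_re, Complex.sub_im, Complex.one_re, Complex.one_im]
    ring
  rw [this]
  exact div_nonneg him (Complex.normSq_nonneg _)

lemma tail_eq (s y : ℝ) (hs : 0 < s) (hy : 0 < y) :
    nG (s + 2*y) s = sin (π*y)/π * nB y (s+1) := by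
  unfold nB
  rw [(beta_real y (s+1) hy (by linarith)).2, nG, show (s-(s+2*y))/2+1 = 1-y by ring,
    show (s+(s+2*y))/2+1 = y+(s+1) by ring]
  have h := Gamma_mul_Gamma_one_sub y
  have hg := (Gamma_pos_of_pos hy).ne'
  have h2 : (Gamma (1-y))⁻¹ = Gamma y * (sin (π*y)/π) := by
    have : Gamma (1-y) = (Gamma y)⁻¹ * (π / sin (π*y)) := by
      rw [← h]; field_simp
    rw [this, mul_inv, inv_inv, inv_div]
  rw [h2]; ring

lemma tail (s α : ℝ) (hs : 0 < s) (hα : 0 < α) (hα1 : α ≤ 1) :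
    Summable (fun k : ℕ => nG (s + 2*(α*(k+1))) s) ∧
    0 ≤ ∑' k : ℕ, nG (s + 2*(α*(k+1))) s := by
  let F : ℕ → ℝ → ℝ := fun k t => sin (π*(α*(k+1)))/π * (t^(α*(k+1)-1) * (1-t)^(s+1-1))
  have hpos : ∀ k : ℕ, 0 < α*((k:ℝ)+1) := fun k => by positivity
  have hint : ∀ k, IntegrableOn (F k) (Set.Ioo 0 1) := fun k =>
    (beta_real (α*(k+1)) (s+1) (hpos k) (by linarith)).1.const_mul _
  have hFe : ∀ k, ∫ t in Set.Ioo 0 1, F k t = nG (s + 2*(α*(k+1))) s := by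
    intro k
    rw [tail_eq s _ hs (hpos k), nB, ← integral_const_mul]
  have hsumm : Summable fun k => ∫ t in Set.Ioo 0 1, ‖F k t‖ := by
    refine Summable.of_nonneg_of_le (fun k => integral_nonneg fun t => norm_nonneg _) ?_
      (nB_summable s α hs hα hα1)
    intro k
    have hb := (beta_real (α*(k+1)) (s+1) (hpos k) (by linarith)).1
    refine setIntegral_mono_on (hint k).norm hb measurableSet_Ioo ?_
    intro t ht
    have := ht.1.le
    have : 0 ≤ 1 - t := by linarith [ht.2]
    have hp : 0 ≤ t^(α*((k:ℝ)+1)-1) * (1-t)^(s+1-1) := by positivity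
    simp only [F]
    rw [norm_mul, norm_of_nonneg hp]
    refine mul_le_of_le_one_left hp ?_
    rw [norm_div, norm_of_nonneg pi_pos.le, div_le_one pi_pos]
    exact (abs_sin_le_one _).trans (by linarith [pi_gt_three])
  have h := hasSum_integral_of_summable_integral_norm hint hsumm
  simp only [hFe] at h
  refine ⟨h.summable, ?_⟩
  rw [h.tsum_eq]
  refine setIntegral_nonneg measurableSet_Ioo fun t ht => ?_
  have ht0 := ht.1
  have h1 : 0 ≤ 1 - t := by linarith [ht.2]
  have e : ∀ k : ℕ, F k t = ((1-t)^(s+1-1) / (π * t)) * (sin (π*α*(k+1)) * (t^α)^(k+1)) := by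
    intro k
    simp only [F]
    rw [rpow_sub_one ht0.ne', ← mul_assoc π α, ← rpow_natCast (t^α), ← rpow_mul ht0.le]
    push_cast
    field_simp
  simp_rw [e]
  rw [tsum_mul_left]
  refine mul_nonneg (by positivity) (sin_sum_nonneg (π*α) (t^α) (by positivity) ?_
    (by positivity) (rpow_lt_one ht0.le ht.2 hα))
  nlinarith [pi_pos]

lemma nG_neg (c s : ℝ) : nG (-c) s = nG c s := by
  unfold nG
  rw [sub_neg_eq_add, ← sub_eq_add_neg]; ring

lemma main_ineq (m : ℕ) (hm : 0 < m) (α : ℝ) (hα : 0 < α) (hα1 : α ≤ 1) :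
    α * ∑ i ∈ Finset.range (m+1), nG (α*m - 2*(α*i)) (α*m) ≤ 2^(α*m) := by
  set s := α*m with hsdef
  have hm' : (0:ℝ) < m := by exact_mod_cast hm
  have hs : 0 < s := by positivity
  obtain ⟨hb, hb0⟩ := tail s α hs hα hα1
  set B := ∑' k : ℕ, nG (s + 2*(α*(k+1))) s with hB
  have h1 : HasSum (fun n : ℕ => nG (s - 2*(α*((n:ℤ):ℝ))) s)
      (B + ∑ i ∈ Finset.range (m+1), nG (s - 2*(α*((i:ℤ):ℝ))) s) := by
    rw [← hasSum_nat_add_iff (f := fun n : ℕ => nG (s - 2*(α*((n:ℤ):ℝ))) s) (m+1)]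
    have e : ∀ k : ℕ, nG (s - 2*(α*(((k+(m+1) : ℕ):ℤ):ℝ))) s = nG (s + 2*(α*(k+1))) s := by
      intro k
      rw [← nG_neg]
      congr 1
      push_cast; rw [hsdef]; ring
    simp only [e]
    exact hb.hasSum
  have h2 : HasSum (fun n : ℕ => nG (s - 2*(α*((-((n:ℤ)+1) : ℤ):ℝ))) s) B := by
    convert hb.hasSum using 2 with k
    congr 1
    push_cast; ring
  have h3 := HasSum.of_nat_of_neg_add_one (f := fun j : ℤ => nG (s - 2*(α*(j:ℝ))) s) h1 h2
  have h4 := fourier_sum s α hs hα hα1 (by simp only [nFG _ s hs]; exact h3.summable)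
  simp only [nFG _ s hs] at h4
  have h5 := h4.unique (h3.mul_left α)
  rw [h5]
  simp only [Int.cast_natCast]
  nlinarith [mul_nonneg hα.le hb0]

theorem neo_classical_inequality (m : ℕ) (p : ℝ) (hp : 1 ≤ p) :
    ∑ i ∈ Finset.range (m + 1),
        1 / (Real.Gamma ((i : ℝ) / p + 1) * Real.Gamma (((m : ℝ) - (i : ℝ)) / p + 1))
      ≤ p * 2 ^ ((m : ℝ) / p) / Real.Gamma ((m : ℝ) / p + 1) := by
  have hp0 : 0 < p := by linarith
  rcases Nat.eq_zero_or_pos m with rfl | hm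
  · simpa using hp
  have h := main_ineq m hm (1/p) (by positivity) (by rw [div_le_one hp0]; exact hp)
  rw [show 1/p*m = m/p by ring] at h
  have hG := Gamma_pos_of_pos (show (0:ℝ) < m/p+1 by positivity)
  rw [le_div_iff₀ hG]
  have e : ∑ i ∈ Finset.range (m+1), nG (m/p - 2*(1/p*i)) (m/p) =
     (∑ i ∈ Finset.range (m + 1),
        1 / (Real.Gamma ((i : ℝ) / p + 1) * Real.Gamma (((m : ℝ) - (i : ℝ)) / p + 1))) *
        Gamma (m/p+1) := by
    rw [Finset.sum_mul]
    refine Finset.sum_congr rfl fun i _ => ?_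
    rw [nG, show ((m:ℝ)/p - (m/p - 2*(1/p*i)))/2+1 = i/p+1 by ring,
      show ((m:ℝ)/p + (m/p - 2*(1/p*i)))/2+1 = (m-i)/p+1 by ring, one_div, mul_inv]
    ring
  rw [← e]
  rw [one_div_mul_eq_div, div_le_iff₀ hp0] at h
  linarith
end

section
/- Let γ = (x_t, y_t) be a continuous bounded-variation path in ℝ² with γ₀ = (0,0) and γ₁ = (1,0), and suppose ∫₀¹ e^{2kπi x_s + λ i y_s} dy_s = 0 for some k ∈ ℤ∖{0} and λ ∈ ℝ∖{0}. Then ∫₀¹ e^{2kπi x_s + λ i y_s} dx_s = 0. -/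
open MeasureTheory Set Complex

theorem aux_partition (G : ℝ → ℂ) (m : ℝ → ℝ) (hG : G 0 = 0) (hm : m 0 = 0)
    (h : ∀ ε > 0, ∃ δ > 0, ∀ s t : ℝ, 0 ≤ s → s ≤ t → t ≤ 1 → t - s < δ →
      ‖G t - G s‖ ≤ ε * (m t - m s)) : G 1 = 0 := by
  have key : ∀ ε > 0, ‖G 1‖ ≤ ε * m 1 := by
    intro ε hε
    obtain ⟨δ, hδ, H⟩ := h ε hε
    obtain ⟨n, hn⟩ := exists_nat_one_div_lt hδ
    have hN : (0 : ℝ) < (n : ℝ) + 1 := by positivity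
    have ind : ∀ i : ℕ, i ≤ n + 1 → ‖G (i / ((n : ℝ) + 1))‖ ≤ ε * m (i / ((n : ℝ) + 1)) := by
      intro i
      induction i with
      | zero => intro _; simp [hG, hm]
      | succ j ih =>
        intro hj
        have h1 := ih (by omega)
        have h2 := H (j / ((n : ℝ) + 1)) ((j + 1 : ℕ) / ((n : ℝ) + 1)) (by positivity)
          (by gcongr; omega)
          (by rw [div_le_one hN]; exact_mod_cast hj)
          (by rw [← sub_div]; push_cast; simpa using hn)
        have h3 := norm_le_norm_add_norm_sub' (G ((j + 1 : ℕ) / ((n : ℝ) + 1))) (G (j / ((n : ℝ) + 1)))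
        linarith
    have := ind (n + 1) le_rfl
    push_cast at this
    rwa [div_self hN.ne'] at this
  have hlim : Filter.Tendsto (fun ε : ℝ => ε * m 1) (nhdsWithin 0 (Ioi 0)) (nhds 0) := by
    have : Filter.Tendsto (fun ε : ℝ => ε * m 1) (nhds 0) (nhds (0 * m 1)) :=
      (continuous_id.mul continuous_const).tendsto 0
    rw [zero_mul] at this
    exact this.mono_left nhdsWithin_le_nhds
  have h0 : ‖G 1‖ ≤ 0 := ge_of_tendsto hlim (by
    filter_upwards [self_mem_nhdsWithin] with ε hε using key ε hε)
  simpa using h0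

theorem aux_int (μ : Measure ℝ) (F : ℝ → ℂ) (g : ℝ → ℝ) (s t ε : ℝ) (hst : s ≤ t)
    (hg : IntervalIntegrable g μ s t)
    (hFg : IntervalIntegrable (fun r => F r * (g r : ℂ)) μ s t)
    (hF : ∀ r ∈ Ioc s t, ‖F r - F s‖ ≤ ε) :
    ‖(∫ r in s..t, F r * (g r : ℂ) ∂μ) - F s * ((∫ r in s..t, g r ∂μ : ℝ) : ℂ)‖
      ≤ ε * ∫ r in s..t, |g r| ∂μ := by
  have hgc : IntervalIntegrable (fun r => (g r : ℂ)) μ s t := ⟨hg.1.ofReal, hg.2.ofReal⟩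
  rw [← intervalIntegral.integral_ofReal, ← intervalIntegral.integral_const_mul,
    ← intervalIntegral.integral_sub hFg (hgc.const_mul _), ← intervalIntegral.integral_const_mul]
  refine intervalIntegral.norm_integral_le_of_norm_le hst ?_ (hg.abs.const_mul ε)
  refine Filter.Eventually.of_forall fun r hr => ?_
  rw [← sub_mul, norm_mul, Complex.norm_real, Real.norm_eq_abs]
  exact mul_le_mul_of_nonneg_right (hF r hr) (abs_nonneg _)

/-- Data attached to one coordinate. -/
theorem aux_coord (x : ℝ → ℝ) (ν : Measure ℝ) (g : ℝ → ℝ)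
    (hg : Integrable g (ν.restrict (Icc 0 1)))
    (hlink : ∀ a b : ℝ, 0 ≤ a → a ≤ b → b ≤ 1 → ∫ t in Icc a b, g t ∂ν = x b - x a)
    (F : ℝ → ℂ) (hF : ContinuousOn F (Icc 0 1)) :
    (∀ s t : ℝ, 0 ≤ s → s ≤ t → t ≤ 1 → IntervalIntegrable g ν s t ∧
      IntervalIntegrable (fun r => F r * (g r : ℂ)) ν s t ∧
      ∫ r in s..t, g r ∂ν = x t - x s) ∧
    ∫ r in Icc (0 : ℝ) 1, F r * (g r : ℂ) ∂ν = ∫ r in (0 : ℝ)..1, F r * (g r : ℂ) ∂ν := by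
  have hFg : IntegrableOn (fun r => F r * (g r : ℂ)) (Icc 0 1) ν := by
    obtain ⟨C, hC⟩ := isCompact_Icc.exists_bound_of_continuousOn hF
    refine Integrable.bdd_mul (c := C) hg.ofReal (hF.aestronglyMeasurable measurableSet_Icc) ?_
    exact (ae_restrict_iff' measurableSet_Icc).2 (Filter.Eventually.of_forall hC)
  have hgI : IntegrableOn g (Icc 0 1) ν := hg
  have hpt : ∀ a : ℝ, 0 ≤ a → a ≤ 1 → ν.real {a} * g a = 0 := by
    intro a h0 h1
    have := hlink a a h0 le_rfl h1
    simpa [integral_singleton, Measure.real] using this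
  refine ⟨fun s t h0 hst h1 => ⟨?_, ?_, ?_⟩, ?_⟩
  · rw [intervalIntegrable_iff_integrableOn_Ioc_of_le hst]
    exact hgI.mono_set (Ioc_subset_Icc_self.trans (Icc_subset_Icc h0 h1))
  · rw [intervalIntegrable_iff_integrableOn_Ioc_of_le hst]
    exact hFg.mono_set (Ioc_subset_Icc_self.trans (Icc_subset_Icc h0 h1))
  · rw [← hlink s t h0 hst h1, intervalIntegral.integral_of_le hst, ← Ioc_union_left hst,
      setIntegral_union (by simp) (measurableSet_singleton _)
        (hgI.mono_set (Ioc_subset_Icc_self.trans (Icc_subset_Icc h0 h1)))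
        (hgI.mono_set (by simpa using ⟨h0, hst.trans h1⟩)), integral_singleton]
    simp [hpt s h0 (hst.trans h1)]
  · rw [intervalIntegral.integral_of_le zero_le_one, ← Ioc_union_left (zero_le_one' ℝ),
      setIntegral_union (by simp) (measurableSet_singleton _)
        (hFg.mono_set Ioc_subset_Icc_self)
        (hFg.mono_set (by simp)), integral_singleton]
    have := hpt 0 le_rfl zero_le_one
    have h2 : ((ν.real {0} : ℝ) : ℂ) * (g 0 : ℂ) = 0 := by exact_mod_cast this
    rw [Complex.real_smul, mul_left_comm, h2]
    simp

theorem aux_chain (x y : ℝ → ℝ)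
    (hx : ContinuousOn x (Icc 0 1)) (hy : ContinuousOn y (Icc 0 1))
    (νx νy : Measure ℝ) (gx gy : ℝ → ℝ)
    (hgx : Integrable gx (νx.restrict (Icc 0 1)))
    (hgy : Integrable gy (νy.restrict (Icc 0 1)))
    (hlinkx : ∀ a b : ℝ, 0 ≤ a → a ≤ b → b ≤ 1 →
      ∫ t in Icc a b, gx t ∂νx = x b - x a)
    (hlinky : ∀ a b : ℝ, 0 ≤ a → a ≤ b → b ≤ 1 →
      ∫ t in Icc a b, gy t ∂νy = y b - y a) (α β : ℂ)
    (F : ℝ → ℂ) (hFdef : ∀ t, F t = Complex.exp (α * x t + β * y t)) :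
    F 1 - F 0 - α * (∫ t in Icc (0 : ℝ) 1, F t * (gx t : ℂ) ∂νx)
      - β * (∫ t in Icc (0 : ℝ) 1, F t * (gy t : ℂ) ∂νy) = 0 := by
  have hu : ContinuousOn (fun t => α * (x t : ℂ) + β * (y t : ℂ)) (Icc 0 1) :=
    (continuousOn_const.mul (Complex.continuous_ofReal.comp_continuousOn hx)).add
      (continuousOn_const.mul (Complex.continuous_ofReal.comp_continuousOn hy))
  have hF : ContinuousOn F (Icc 0 1) := by
    rw [funext hFdef]
    exact Complex.continuous_exp.comp_continuousOn hu
  obtain ⟨cx, ex⟩ := aux_coord x νx gx hgx hlinkx F hF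
  obtain ⟨cy, ey⟩ := aux_coord y νy gy hgy hlinky F hF
  rw [ex, ey]
  obtain ⟨C, hC⟩ := isCompact_Icc.exists_bound_of_continuousOn hF
  have hC0 : 0 ≤ C := (norm_nonneg _).trans (hC 0 (by simp))
  refine aux_partition (fun t => F t - F 0 - α * (∫ r in (0 : ℝ)..t, F r * (gx r : ℂ) ∂νx)
      - β * (∫ r in (0 : ℝ)..t, F r * (gy r : ℂ) ∂νy))
    (fun t => ‖α‖ * (∫ r in (0 : ℝ)..t, |gx r| ∂νx) + ‖β‖ * (∫ r in (0 : ℝ)..t, |gy r| ∂νy))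
    (by simp) (by simp) ?_
  intro ε hε
  have uF := Metric.uniformContinuousOn_iff.1
    (isCompact_Icc.uniformContinuousOn_of_continuous hF) (ε / 2) (by positivity)
  have uu := Metric.uniformContinuousOn_iff.1
    (isCompact_Icc.uniformContinuousOn_of_continuous hu) (min 1 (ε / (2 * (C + 1)))) (by positivity)
  obtain ⟨δ₁, hδ₁, H1⟩ := uF
  obtain ⟨δ₂, hδ₂, H2⟩ := uu
  refine ⟨min δ₁ δ₂, by positivity, fun s t h0 hst h1 hd => ?_⟩
  have hs : s ∈ Icc (0 : ℝ) 1 := ⟨h0, hst.trans h1⟩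
  have ht : t ∈ Icc (0 : ℝ) 1 := ⟨h0.trans hst, h1⟩
  obtain ⟨gx0, Fx0, -⟩ := cx 0 s le_rfl h0 hs.2
  obtain ⟨gy0, Fy0, -⟩ := cy 0 s le_rfl h0 hs.2
  obtain ⟨gxs, Fxs, lx⟩ := cx s t h0 hst h1
  obtain ⟨gys, Fys, ly⟩ := cy s t h0 hst h1
  have hosc : ∀ r ∈ Ioc s t, ‖F r - F s‖ ≤ ε / 2 := by
    intro r hr
    rw [← dist_eq_norm]
    refine (H1 r ⟨h0.trans hr.1.le, hr.2.trans h1⟩ s hs ?_).le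
    rw [Real.dist_eq, abs_of_pos (sub_pos.2 hr.1)]
    have := min_le_left δ₁ δ₂
    linarith [hr.2]
  have bx := aux_int νx F gx s t _ hst gxs Fxs hosc
  have b_y := aux_int νy F gy s t _ hst gys Fys hosc
  have ax : |x t - x s| ≤ ∫ r in s..t, |gx r| ∂νx := by
    rw [← lx]; exact intervalIntegral.abs_integral_le_integral_abs hst
  have ay : |y t - y s| ≤ ∫ r in s..t, |gy r| ∂νy := by
    rw [← ly]; exact intervalIntegral.abs_integral_le_integral_abs hst
  have dU := H2 t ht s hs (by
    rw [Real.dist_eq, abs_of_nonneg (sub_nonneg.2 hst)]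
    exact hd.trans_le (min_le_right _ _))
  rw [dist_eq_norm] at dU
  rw [lx] at bx
  rw [ly] at b_y
  beta_reduce
  rw [← intervalIntegral.integral_add_adjacent_intervals Fx0 Fxs,
    ← intervalIntegral.integral_add_adjacent_intervals Fy0 Fys,
    ← intervalIntegral.integral_add_adjacent_intervals gx0.abs gxs.abs,
    ← intervalIntegral.integral_add_adjacent_intervals gy0.abs gys.abs]
  set X := ∫ r in s..t, |gx r| ∂νx
  set Y := ∫ r in s..t, |gy r| ∂νy
  set IX := ∫ r in s..t, F r * (gx r : ℂ) ∂νx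
  set IY := ∫ r in s..t, F r * (gy r : ℂ) ∂νy
  set U := α * (x t : ℂ) + β * (y t : ℂ) - (α * (x s : ℂ) + β * (y s : ℂ)) with hU
  have hUn : ‖U‖ ≤ ‖α‖ * X + ‖β‖ * Y := by
    have : U = α * ((x t - x s : ℝ) : ℂ) + β * ((y t - y s : ℝ) : ℂ) := by
      rw [hU]; push_cast; ring
    rw [this]
    refine (norm_add_le _ _).trans ?_
    rw [norm_mul, norm_mul, Complex.norm_real, Complex.norm_real, Real.norm_eq_abs,
      Real.norm_eq_abs]
    gcongr
  have hFt : F t = F s * Complex.exp U := by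
    rw [hFdef, hFdef, ← Complex.exp_add, hU]; congr 1; ring
  have hE : ‖F s * (Complex.exp U - 1 - U)‖ ≤ ε / 2 * (‖α‖ * X + ‖β‖ * Y) := by
    rw [norm_mul]
    have e1 := Complex.norm_exp_sub_one_sub_id_le (dU.le.trans (min_le_left _ _))
    have e2 : ‖U‖ ≤ ε / (2 * (C + 1)) := dU.le.trans (min_le_right _ _)
    calc ‖F s‖ * ‖Complex.exp U - 1 - U‖ ≤ (C + 1) * (‖U‖ * ‖U‖) := by
          gcongr
          · linarith [hC s hs]
          · rw [← sq]; exact e1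
      _ ≤ (C + 1) * (ε / (2 * (C + 1)) * (‖α‖ * X + ‖β‖ * Y)) := by gcongr
      _ = _ := by field_simp
  have hid : ∀ A B : ℂ, F t - F 0 - α * (A + IX) - β * (B + IY) - (F s - F 0 - α * A - β * B)
      = F s * (Complex.exp U - 1 - U) - α * (IX - F s * ((x t - x s : ℝ) : ℂ))
        - β * (IY - F s * ((y t - y s : ℝ) : ℂ)) := by
    intro A B
    rw [hFt, hU]; push_cast; ring
  rw [hid]
  have n1 : ‖α * (IX - F s * ((x t - x s : ℝ) : ℂ))‖ ≤ ‖α‖ * (ε / 2 * X) := by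
    rw [norm_mul]; gcongr
  have n2 : ‖β * (IY - F s * ((y t - y s : ℝ) : ℂ))‖ ≤ ‖β‖ * (ε / 2 * Y) := by
    rw [norm_mul]; gcongr
  have n3 := norm_sub_le (F s * (Complex.exp U - 1 - U) - α * (IX - F s * ((x t - x s : ℝ) : ℂ)))
    (β * (IY - F s * ((y t - y s : ℝ) : ℂ)))
  have n4 := norm_sub_le (F s * (Complex.exp U - 1 - U)) (α * (IX - F s * ((x t - x s : ℝ) : ℂ)))
  linarith

/-- Let `γ = (x,y)` be a continuous bounded-variation path in `ℝ²`
with `γ₀ = (0,0)`, `γ₁ = (1,0)`.  The Lebesgue–Stieltjes measures `dx` and `dy` are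
encoded by finite measures `νx, νy` with densities `gx, gy` (so that
`∫_{[a,b]} gx dνx = x_b − x_a` and `∫_{[a,b]} gy dνy = y_b − y_a`).
If `∫₀¹ e^{2kπi x_s + λ i y_s} dy_s = 0` for some `k ∈ ℤ∖{0}` and `λ ∈ ℝ∖{0}`,
then `∫₀¹ e^{2kπi x_s + λ i y_s} dx_s = 0`. -/
theorem dx_integral_vanishes_of_dy_integral_vanishes
    (x y : ℝ → ℝ)
    (hx : ContinuousOn x (Icc 0 1)) (hy : ContinuousOn y (Icc 0 1))
    (hx0 : x 0 = 0) (hy0 : y 0 = 0) (hx1 : x 1 = 1) (hy1 : y 1 = 0)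
    (νx νy : Measure ℝ) [IsFiniteMeasure νx] [IsFiniteMeasure νy]
    (gx gy : ℝ → ℝ)
    (hgx : Integrable gx (νx.restrict (Icc 0 1)))
    (hgy : Integrable gy (νy.restrict (Icc 0 1)))
    (hlinkx : ∀ a b : ℝ, 0 ≤ a → a ≤ b → b ≤ 1 →
      ∫ t in Icc a b, gx t ∂νx = x b - x a)
    (hlinky : ∀ a b : ℝ, 0 ≤ a → a ≤ b → b ≤ 1 →
      ∫ t in Icc a b, gy t ∂νy = y b - y a)
    (k : ℤ) (hk : k ≠ 0) (l : ℝ) (hl : l ≠ 0)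
    (hint : ∫ t in Icc (0 : ℝ) 1,
        Complex.exp (2 * k * Real.pi * Complex.I * (x t) + l * Complex.I * (y t))
          * (gy t : ℂ) ∂νy = 0) :
    ∫ t in Icc (0 : ℝ) 1,
        Complex.exp (2 * k * Real.pi * Complex.I * (x t) + l * Complex.I * (y t))
          * (gx t : ℂ) ∂νx = 0 := by
  have h := aux_chain x y hx hy νx νy gx gy hgx hgy hlinkx hlinky
    (2 * k * Real.pi * Complex.I) (l * Complex.I) _ (fun t => rfl)
  rw [hint, hx0, hy0, hx1, hy1] at h
  have h1 : Complex.exp (2 * k * Real.pi * Complex.I * ((1 : ℝ) : ℂ)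
      + l * Complex.I * ((0 : ℝ) : ℂ)) = 1 := by
    rw [Complex.exp_eq_one_iff]
    exact ⟨k, by push_cast; ring⟩
  rw [h1] at h
  have hne : (2 * k * Real.pi * Complex.I : ℂ) ≠ 0 := by
    simp [hk, Real.pi_ne_zero]
  simp only [Complex.ofReal_zero, mul_zero, add_zero, Complex.exp_zero, sub_self, zero_sub,
    sub_zero, neg_eq_zero] at h
  exact (mul_eq_zero.1 h).resolve_left hne
end

section
/- Combinatorial partial-fraction identity: Let 0 ≤ s ≤ R and let c₁, …, c_{R+1} be elements of a field such that all the consecutive sums appearing below are nonzero. Let 𝒯(s, R−s) be the set of permutations η of {1,…,R+1} with η(s+1) = 1, η(s) < η(s−1) < ⋯ < η(1) replaced by η(s) < ⋯ < η(1) being increasing when read as η(s), η(s−1), …, η(1), i.e. η(s) < η(s−1) < ⋯ < η(1), and η(s+2) < η(s+3) < ⋯ < η(R+1). For η ∈ 𝒯(s, R−s) and 2 ≤ k ≤ R+1 write c_{η^{-1}(2)}^{η^{-1}(k)} := c_{η^{-1}(2)} + c_{η^{-1}(3)} + ⋯ + c_{η^{-1}(k)}. Then Σ_{η ∈ 𝒯(s,R−s)}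 1/(c_{η^{-1}(2)}^{η^{-1}(2)} · c_{η^{-1}(2)}^{η^{-1}(3)} ⋯ c_{η^{-1}(2)}^{η^{-1}(R+1)}) = (Π_{k=1}^{s} c_k^s)^{-1} · (Π_{k=s+2}^{R+1} c_{s+2}^k)^{-1}, where c_p^q := c_p + c_{p+1} + ⋯ + c_q and empty products are 1. -/
noncomputable section

/-- The set `𝒯(s, R−s)` of permutations `η` of `{1,…,R+1}` (realised `0`-based on
`Fin (R+1)`) with `η(s+1) = 1`, `η(s) < η(s−1) < ⋯ < η(1)` and
`η(s+2) < η(s+3) < ⋯ < η(R+1)`. -/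
def shuffleT (R s : ℕ) (hs : s ≤ R) : Finset (Equiv.Perm (Fin (R + 1))) :=
  Finset.univ.filter (fun η =>
    η ⟨s, Nat.lt_succ_of_le hs⟩ = ⟨0, Nat.succ_pos R⟩ ∧
    (∀ i j : Fin (R + 1), i < j → (j : ℕ) < s → η j < η i) ∧
    (∀ i j : Fin (R + 1), i < j → s < (i : ℕ) → η i < η j))

/-- `c_{η⁻¹(2)}^{η⁻¹(k)} = c_{η⁻¹(2)} + c_{η⁻¹(3)} + ⋯ + c_{η⁻¹(k)}` (indices
`1`-based as in the paper; the `0`-based value `r` corresponds to `r+1`). -/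
def etaSum {F : Type*} [Field F] (R : ℕ) (c : Fin (R + 1) → F)
    (η : Equiv.Perm (Fin (R + 1))) (k : ℕ) : F :=
  ∑ r : Fin (R + 1), if 1 ≤ (r : ℕ) ∧ (r : ℕ) + 1 ≤ k then c (η.symm r) else 0

/-- `c_p^q = c_p + c_{p+1} + ⋯ + c_q` (indices `1`-based). -/
def cSum {F : Type*} [Field F] (R : ℕ) (c : Fin (R + 1) → F) (p q : ℕ) : F :=
  ∑ r : Fin (R + 1), if p ≤ (r : ℕ) + 1 ∧ (r : ℕ) + 1 ≤ q then c r else 0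

/-- Extend `e` by sending the new position `p` to the last value. -/
def extP {n : ℕ} (p : Fin (n + 1)) (e : Equiv.Perm (Fin n)) : Equiv.Perm (Fin (n + 1)) :=
  (finSuccEquiv' p).trans ((Equiv.optionCongr e).trans (finSuccEquiv' (Fin.last n)).symm)

theorem extP_self {n : ℕ} (p : Fin (n + 1)) (e : Equiv.Perm (Fin n)) :
    extP p e p = Fin.last n := by
  simp [extP]

theorem extP_succAbove {n : ℕ} (p : Fin (n + 1)) (e : Equiv.Perm (Fin n)) (i : Fin n) :
    extP p e (p.succAbove i) = (e i).castSucc := by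
  simp [extP]

theorem extP_symm_castSucc {n : ℕ} (p : Fin (n + 1)) (e : Equiv.Perm (Fin n)) (i : Fin n) :
    (extP p e).symm i.castSucc = p.succAbove (e.symm i) := by
  rw [Equiv.symm_apply_eq, extP_succAbove]; simp

theorem extP_injective {n : ℕ} (p : Fin (n + 1)) : Function.Injective (extP p) := by
  intro e f h
  ext i
  have := congrArg (fun g => g (p.succAbove i)) h
  simp only [extP_succAbove] at this
  simpa [Fin.ext_iff] using this

theorem extP_surj {n : ℕ} (p : Fin (n + 1)) (η : Equiv.Perm (Fin (n + 1)))
    (h : η p = Fin.last n) : ∃ e, extP p e = η := by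
  have h1 : ∀ i, ∃ j : Fin n, η (p.succAbove i) = j.castSucc := by
    intro i
    have : η (p.succAbove i) ≠ Fin.last n := by
      rw [← h]
      intro h'
      exact Fin.succAbove_ne p i (η.injective h')
    exact ⟨(η (p.succAbove i)).castPred this, by simp⟩
  choose f hf using h1
  have hinj : Function.Injective f := by
    intro a b hab
    have : η (p.succAbove a) = η (p.succAbove b) := by rw [hf, hf, hab]
    exact Fin.succAbove_right_injective (η.injective this)
  refine ⟨Equiv.ofBijective f (Finite.injective_iff_bijective.mp hinj), ?_⟩
  ext x
  rcases Fin.eq_self_or_eq_succAbove p x with rfl | ⟨i, rfl⟩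
  · rw [extP_self, h]
  · rw [extP_succAbove, hf]; simp

theorem mem_ext_last {R s : ℕ} (hs : s ≤ R) (e : Equiv.Perm (Fin (R + 1))) :
    extP (Fin.last (R + 1)) e ∈ shuffleT (R + 1) s (by omega) ↔ e ∈ shuffleT R s hs := by
  have key : ∀ i : Fin (R + 1), extP (Fin.last (R + 1)) e i.castSucc = (e i).castSucc := by
    intro i
    have := extP_succAbove (Fin.last (R + 1)) e i
    simpa using this
  have e0 : (⟨s, by omega⟩ : Fin (R + 1 + 1)) = (⟨s, by omega⟩ : Fin (R + 1)).castSucc := rfl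
  simp only [shuffleT, Finset.mem_filter, Finset.mem_univ, true_and]
  rw [e0, key]
  constructor
  · rintro ⟨h1, h2, h3⟩
    refine ⟨?_, ?_, ?_⟩
    · exact Fin.ext (congrArg Fin.val h1 :)
    · intro i j hij hj
      have := h2 i.castSucc j.castSucc (by simpa using hij) (by simpa using hj)
      rw [key, key] at this
      simpa using this
    · intro i j hij hj
      have := h3 i.castSucc j.castSucc (by simpa using hij) (by simpa using hj)
      rw [key, key] at this
      simpa using this
  · rintro ⟨h1, h2, h3⟩
    refine ⟨?_, ?_, ?_⟩
    · simp [h1]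
    · intro i j hij hj
      induction j using Fin.lastCases with
      | last => simp at hj; omega
      | cast j =>
        induction i using Fin.lastCases with
        | last => exact absurd hij (not_lt.mpr (Fin.le_last _))
        | cast i =>
          rw [key, key]
          simpa using h2 i j (by simpa using hij) (by simpa using hj)
    · intro i j hij hj
      induction i using Fin.lastCases with
      | last => exact absurd hij (not_lt.mpr (Fin.le_last _))
      | cast i =>
        induction j using Fin.lastCases with
        | last => rw [key, extP_self]; exact Fin.castSucc_lt_last _
        | cast j =>
          rw [key, key]
          simpa using h3 i j (by simpa using hij) (by simpa using hj)

theorem mem_ext_zero {R s : ℕ} (hs : s ≤ R) (e : Equiv.Perm (Fin (R + 1))) :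
    extP 0 e ∈ shuffleT (R + 1) (s + 1) (by omega) ↔ e ∈ shuffleT R s hs := by
  have key : ∀ i : Fin (R + 1), extP 0 e i.succ = (e i).castSucc := by
    intro i
    have := extP_succAbove 0 e i
    simpa using this
  have e0 : (⟨s + 1, by omega⟩ : Fin (R + 1 + 1)) = (⟨s, by omega⟩ : Fin (R + 1)).succ := rfl
  simp only [shuffleT, Finset.mem_filter, Finset.mem_univ, true_and]
  rw [e0, key]
  constructor
  · rintro ⟨h1, h2, h3⟩
    refine ⟨?_, ?_, ?_⟩
    · exact Fin.ext (congrArg Fin.val h1 :)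
    · intro i j hij hj
      have := h2 i.succ j.succ (by simpa using hij) (by simpa using hj)
      rw [key, key] at this
      simpa using this
    · intro i j hij hj
      have := h3 i.succ j.succ (by simpa using hij) (by simpa using hj)
      rw [key, key] at this
      simpa using this
  · rintro ⟨h1, h2, h3⟩
    refine ⟨?_, ?_, ?_⟩
    · simp [h1]
    · intro i j hij hj
      induction j using Fin.cases with
      | zero => exact absurd hij (not_lt.mpr (Fin.zero_le _))
      | succ j =>
        induction i using Fin.cases with
        | zero => rw [key, extP_self]; exact Fin.castSucc_lt_last _
        | succ i =>
          rw [key, key]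
          simpa using h2 i j (by simpa using hij) (by simpa using hj)
    · intro i j hij hj
      induction i using Fin.cases with
      | zero => simp at hj
      | succ i =>
        induction j using Fin.cases with
        | zero => exact absurd hij (not_lt.mpr (Fin.zero_le _))
        | succ j =>
          rw [key, key]
          simpa using h3 i j (by simpa using hij) (by simpa using hj)

theorem shuffleT_cases {R s : ℕ} (hs : s ≤ R + 1) (η : Equiv.Perm (Fin (R + 1 + 1)))
    (h : η ∈ shuffleT (R + 1) s hs) :
    (η 0 = Fin.last (R + 1) ∧ 0 < s) ∨ (η (Fin.last (R + 1)) = Fin.last (R + 1) ∧ s ≤ R) := by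
  simp only [shuffleT, Finset.mem_filter, Finset.mem_univ, true_and] at h
  obtain ⟨h1, h2, h3⟩ := h
  obtain ⟨i, hi⟩ := η.surjective (Fin.last (R + 1))
  rcases lt_trichotomy (i : ℕ) s with hlt | heq | hgt
  · left
    refine ⟨?_, by omega⟩
    by_cases h0 : i = 0
    · rw [← h0, hi]
    · have := h2 0 i (Fin.pos_of_ne_zero h0) hlt
      rw [hi] at this
      exact absurd this (not_lt.mpr (Fin.le_last _))
  · have : i = ⟨s, Nat.lt_succ_of_le hs⟩ := Fin.ext heq
    rw [← this, hi] at h1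
    simp [Fin.ext_iff] at h1
  · right
    have := i.isLt
    refine ⟨?_, by omega⟩
    by_cases h0 : i = Fin.last (R + 1)
    · rw [h0] at hi; exact hi
    · have := h3 i (Fin.last _) (Fin.lt_last_iff_ne_last.mpr h0) hgt
      rw [hi] at this
      exact absurd this (not_lt.mpr (Fin.le_last _))

theorem shuffleT_nonempty (R : ℕ) : ∀ (s : ℕ) (hs : s ≤ R), (shuffleT R s hs).Nonempty := by
  induction R with
  | zero =>
    intro s hs
    refine ⟨1, ?_⟩
    simp only [shuffleT, Finset.mem_filter, Finset.mem_univ, true_and]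
    refine ⟨by ext; simp, ?_, ?_⟩ <;> intro i j hij <;> omega
  | succ R ih =>
    intro s hs
    by_cases h : s ≤ R
    · obtain ⟨e, he⟩ := ih s h
      exact ⟨_, (mem_ext_last h e).mpr he⟩
    · obtain rfl : s = R + 1 := by omega
      obtain ⟨e, he⟩ := ih R le_rfl
      exact ⟨_, (mem_ext_zero le_rfl e).mpr he⟩

section sums
variable {F : Type*} [Field F]

theorem etaSum_extP {R : ℕ} (c : Fin (R + 1 + 1) → F) (p : Fin (R + 1 + 1))
    (e : Equiv.Perm (Fin (R + 1))) (k : ℕ) (hk : k ≤ R + 1) :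
    etaSum (R + 1) c (extP p e) k = etaSum R (fun i => c (p.succAbove i)) e k := by
  unfold etaSum
  rw [Fin.sum_univ_castSucc]
  simp only [extP_symm_castSucc, Fin.val_castSucc, Fin.val_last]
  rw [if_neg (by omega), add_zero]

theorem etaSum_total {R s : ℕ} (hs : s ≤ R) (c : Fin (R + 1) → F)
    (η : Equiv.Perm (Fin (R + 1))) (h : η ∈ shuffleT R s hs) :
    etaSum R c η (R + 1) = cSum R c 1 s + cSum R c (s + 2) (R + 1) := by
  simp only [shuffleT, Finset.mem_filter, Finset.mem_univ, true_and] at h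
  unfold etaSum cSum
  rw [← Finset.sum_add_distrib, ← Equiv.sum_comp η]
  apply Finset.sum_congr rfl
  intro x _
  have hx : (η x : ℕ) = 0 ↔ (x : ℕ) = s := by
    have : (η x = ⟨0, Nat.succ_pos R⟩) ↔ x = ⟨s, Nat.lt_succ_of_le hs⟩ := by
      rw [← h.1]; exact η.injective.eq_iff
    rw [Fin.ext_iff, Fin.ext_iff] at this
    exact this
  have := x.isLt
  have := (η x).isLt
  rw [Equiv.symm_apply_apply]
  rcases lt_trichotomy (x : ℕ) s with hlt | heq | hgt
  · rw [if_pos (by omega), if_pos (by omega), if_neg (by omega), add_zero]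
  · rw [if_neg (by omega), if_neg (by omega), if_neg (by omega), add_zero]
  · rw [if_pos (by omega), if_neg (by omega), if_pos (by omega), zero_add]

theorem cSum_last {R : ℕ} (c : Fin (R + 1 + 1) → F) (p q : ℕ) (hq : q ≤ R + 1) :
    cSum R (fun i => c ((Fin.last (R + 1)).succAbove i)) p q = cSum (R + 1) c p q := by
  unfold cSum
  rw [Fin.sum_univ_castSucc (n := R + 1)]
  simp only [Fin.succAbove_last, Fin.val_castSucc, Fin.val_last]
  rw [if_neg (by omega), add_zero]

theorem cSum_zero {R : ℕ} (c : Fin (R + 1 + 1) → F) (p q : ℕ) (hp : 1 ≤ p) :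
    cSum R (fun i => c ((0 : Fin (R + 1 + 1)).succAbove i)) p q
      = cSum (R + 1) c (p + 1) (q + 1) := by
  unfold cSum
  rw [Fin.sum_univ_succ (n := R + 1)]
  rw [if_neg (by rw [Fin.val_zero]; omega), zero_add]
  apply Finset.sum_congr rfl
  intro x _
  simp only [Fin.succAbove_zero, Fin.val_succ]
  exact if_congr (by omega) rfl rfl

theorem cSum_empty {R : ℕ} (c : Fin (R + 1) → F) (p q : ℕ) (h : q < p) :
    cSum R c p q = 0 := by
  unfold cSum
  apply Finset.sum_eq_zero
  intro x _
  rw [if_neg (by omega)]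

theorem prodIcc_range (f : ℕ → F) (a b : ℕ) :
    ∏ k ∈ Finset.Icc a b, f k = ∏ k ∈ Finset.range (b + 1 - a), f (a + k) := by
  rw [← Finset.prod_Ico_eq_prod_range]
  apply Finset.prod_congr _ (fun _ _ => rfl)
  ext x
  simp only [Finset.mem_Icc, Finset.mem_Ico]
  omega

theorem sum_part {R s s' : ℕ} (hs : s ≤ R + 1) (hs' : s' ≤ R) (c : Fin (R + 1 + 1) → F)
    (p : Fin (R + 1 + 1))
    (hmem : ∀ e, extP p e ∈ shuffleT (R + 1) s hs ↔ e ∈ shuffleT R s' hs') :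
    ∑ η ∈ shuffleT (R + 1) s hs with η p = Fin.last (R + 1),
        (∏ k ∈ Finset.Icc 2 (R + 1 + 1), etaSum (R + 1) c η k)⁻¹
      = (∑ e ∈ shuffleT R s' hs',
        (∏ k ∈ Finset.Icc 2 (R + 1), etaSum R (fun i => c (p.succAbove i)) e k)⁻¹)
        * (cSum (R + 1) c 1 s + cSum (R + 1) c (s + 2) (R + 1 + 1))⁻¹ := by
  rw [Finset.sum_mul]
  symm
  apply Finset.sum_bij (fun e _ => extP p e)
  · intro e he
    rw [Finset.mem_filter]
    exact ⟨(hmem e).mpr he, extP_self p e⟩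
  · intro a _ b _ h
    exact extP_injective p h
  · intro η hη
    rw [Finset.mem_filter] at hη
    obtain ⟨e, rfl⟩ := extP_surj p η hη.2
    exact ⟨e, (hmem e).mp hη.1, rfl⟩
  · intro e he
    rw [Finset.prod_Icc_succ_top (show 2 ≤ R + 1 + 1 by omega), etaSum_total hs c _ ((hmem e).mpr he), mul_inv]
    congr 2
    apply Finset.prod_congr rfl
    intro k hk
    rw [Finset.mem_Icc] at hk
    rw [etaSum_extP c p e k hk.2]

end sums

/-- **combinatorial partial-fraction identity.** Let `0 ≤ s ≤ R` and
`c₁,…,c_{R+1}` be field elements with all the consecutive sums appearing below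
nonzero.  Then
`Σ_{η ∈ 𝒯(s,R−s)} 1/(c_{η⁻¹(2)}^{η⁻¹(2)} ⋯ c_{η⁻¹(2)}^{η⁻¹(R+1)})
  = (Π_{k=1}^{s} c_k^s)⁻¹ (Π_{k=s+2}^{R+1} c_{s+2}^k)⁻¹`. -/
theorem combinatorial_partial_fraction {F : Type*} [Field F]
    (R s : ℕ) (hs : s ≤ R) (c : Fin (R + 1) → F)
    (hden : ∀ η ∈ shuffleT R s hs, ∀ k ∈ Finset.Icc 2 (R + 1), etaSum R c η k ≠ 0)
    (hden1 : ∀ k ∈ Finset.Icc 1 s, cSum R c k s ≠ 0)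
    (hden2 : ∀ k ∈ Finset.Icc (s + 2) (R + 1), cSum R c (s + 2) k ≠ 0) :
    ∑ η ∈ shuffleT R s hs, (∏ k ∈ Finset.Icc 2 (R + 1), etaSum R c η k)⁻¹
      = (∏ k ∈ Finset.Icc 1 s, cSum R c k s)⁻¹
        * (∏ k ∈ Finset.Icc (s + 2) (R + 1), cSum R c (s + 2) k)⁻¹ := by
  induction R generalizing s with
  | zero =>
    obtain rfl : s = 0 := by omega
    obtain ⟨η, hη⟩ := shuffleT_nonempty 0 0 le_rfl
    have : shuffleT 0 0 hs = {η} := by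
      apply Finset.eq_singleton_iff_unique_mem.mpr
      exact ⟨hη, fun x _ => Equiv.ext fun i => Fin.ext (by omega)⟩
    rw [this]
    simp
  | succ R ih =>
    have hAB : cSum (R + 1) c 1 s + cSum (R + 1) c (s + 2) (R + 1 + 1) ≠ 0 := by
      obtain ⟨η, hη⟩ := shuffleT_nonempty (R + 1) s hs
      rw [← etaSum_total hs c η hη]
      exact hden η hη _ (by simp)
    set A := cSum (R + 1) c 1 s with hA
    set B := cSum (R + 1) c (s + 2) (R + 1 + 1) with hB
    set P := ∏ k ∈ Finset.Icc 1 s, cSum (R + 1) c k s with hP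
    set Q := ∏ k ∈ Finset.Icc (s + 2) (R + 1 + 1), cSum (R + 1) c (s + 2) k with hQ
    have hL : ∑ η ∈ shuffleT (R + 1) s hs with η 0 = Fin.last (R + 1),
        (∏ k ∈ Finset.Icc 2 (R + 1 + 1), etaSum (R + 1) c η k)⁻¹
          = A * P⁻¹ * Q⁻¹ * (A + B)⁻¹ := by
      rcases s with _ | s
      · have hA0 : A = 0 := cSum_empty c 1 0 (by omega)
        rw [hA0]
        simp only [zero_mul]
        apply Finset.sum_eq_zero
        intro η hη
        rw [Finset.mem_filter] at hη
        exfalso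
        have h1 := hη.1
        simp only [shuffleT, Finset.mem_filter, Finset.mem_univ, true_and] at h1
        have h2 := h1.1
        have h3 := hη.2
        change η 0 = _ at h2
        rw [h3] at h2
        simp [Fin.ext_iff] at h2
      · have hs' : s ≤ R := by omega
        have hAne : A ≠ 0 := hden1 1 (by simp)
        have hP' : P = A * ∏ k ∈ Finset.Icc 1 s,
            cSum R (fun i => c ((0 : Fin (R + 1 + 1)).succAbove i)) k s := by
          rw [hP, prodIcc_range, prodIcc_range]
          simp only [Nat.add_sub_cancel]
          rw [Finset.prod_range_succ', mul_comm]
          congr 1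
          apply Finset.prod_congr rfl
          intro k _
          rw [cSum_zero c _ _ (by omega)]
          congr 1
        have hQ' : Q = ∏ k ∈ Finset.Icc (s + 2) (R + 1),
            cSum R (fun i => c ((0 : Fin (R + 1 + 1)).succAbove i)) (s + 2) k := by
          rw [hQ, prodIcc_range, prodIcc_range]
          have e1 : R + 1 + 1 + 1 - (s + 1 + 2) = R + 1 + 1 - (s + 2) := by omega
          rw [e1]
          apply Finset.prod_congr rfl
          intro k _
          rw [cSum_zero c _ _ (by omega)]
          congr 1
          omega
        rw [sum_part hs hs' c 0 (fun e => mem_ext_zero hs' e)]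
        rw [ih s hs' (fun i => c ((0 : Fin (R + 1 + 1)).succAbove i))]
        · rw [← hQ', hP', ← hA, ← hB, mul_inv, ← mul_assoc A, mul_inv_cancel₀ hAne, one_mul]
        · intro e he k hk
          have hk2 := Finset.mem_Icc.mp hk
          rw [← etaSum_extP c 0 e k hk2.2]
          exact hden _ ((mem_ext_zero hs' e).mpr he) k (Finset.mem_Icc.mpr (by omega))
        · intro k hk
          have hk2 := Finset.mem_Icc.mp hk
          rw [cSum_zero c _ _ (by omega)]
          exact hden1 _ (Finset.mem_Icc.mpr (by omega))
        · intro k hk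
          have hk2 := Finset.mem_Icc.mp hk
          rw [cSum_zero c _ _ (by omega)]
          exact hden2 _ (Finset.mem_Icc.mpr (by omega))
    have hR : ∑ η ∈ shuffleT (R + 1) s hs with η (Fin.last (R + 1)) = Fin.last (R + 1),
        (∏ k ∈ Finset.Icc 2 (R + 1 + 1), etaSum (R + 1) c η k)⁻¹
          = B * P⁻¹ * Q⁻¹ * (A + B)⁻¹ := by
      by_cases hs' : s ≤ R
      · have hBne : B ≠ 0 := hden2 _ (Finset.mem_Icc.mpr (by omega))
        have hP' : P = ∏ k ∈ Finset.Icc 1 s,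
            cSum R (fun i => c ((Fin.last (R + 1)).succAbove i)) k s := by
          apply Finset.prod_congr rfl
          intro k _
          rw [cSum_last c _ _ (by omega)]
        have hQ' : Q = (∏ k ∈ Finset.Icc (s + 2) (R + 1),
            cSum R (fun i => c ((Fin.last (R + 1)).succAbove i)) (s + 2) k) * B := by
          rw [hQ, Finset.prod_Icc_succ_top (by omega)]
          congr 1
          apply Finset.prod_congr rfl
          intro k hk
          have hk2 := Finset.mem_Icc.mp hk
          rw [cSum_last c _ _ (by omega)]
        rw [sum_part hs hs' c (Fin.last (R + 1)) (fun e => mem_ext_last hs' e)]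
        rw [ih s hs' (fun i => c ((Fin.last (R + 1)).succAbove i))]
        · rw [← hP', hQ', ← hA, ← hB, mul_inv]
          field_simp
        · intro e he k hk
          have hk2 := Finset.mem_Icc.mp hk
          rw [← etaSum_extP c _ e k hk2.2]
          exact hden _ ((mem_ext_last hs' e).mpr he) k (Finset.mem_Icc.mpr (by omega))
        · intro k hk
          have hk2 := Finset.mem_Icc.mp hk
          rw [cSum_last c _ _ (by omega)]
          exact hden1 _ hk
        · intro k hk
          have hk2 := Finset.mem_Icc.mp hk
          rw [cSum_last c _ _ (by omega)]
          exact hden2 _ (Finset.mem_Icc.mpr (by omega))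
      · have hB0 : B = 0 := cSum_empty c _ _ (by omega)
        rw [hB0]
        simp only [zero_mul]
        apply Finset.sum_eq_zero
        intro η hη
        rw [Finset.mem_filter] at hη
        exfalso
        have h1 := hη.1
        simp only [shuffleT, Finset.mem_filter, Finset.mem_univ, true_and] at h1
        have h2 := h1.1
        have h3 := hη.2
        have h4 : (⟨s, Nat.lt_succ_of_le hs⟩ : Fin (R + 1 + 1)) = Fin.last (R + 1) := by
          apply Fin.ext
          simp only [Fin.val_last]
          omega
        rw [h4, h3] at h2
        simp [Fin.ext_iff] at h2
    have hfil : (shuffleT (R + 1) s hs).filter (fun η => ¬ η 0 = Fin.last (R + 1))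
        = (shuffleT (R + 1) s hs).filter
          (fun η => η (Fin.last (R + 1)) = Fin.last (R + 1)) := by
      apply Finset.filter_congr
      intro η hη
      constructor
      · intro h
        rcases shuffleT_cases hs η hη with h' | h'
        · exact absurd h'.1 h
        · exact h'.1
      · intro h h'
        have := η.injective (h.trans h'.symm)
        simp [Fin.ext_iff] at this
    rw [← Finset.sum_filter_add_sum_filter_not (shuffleT (R + 1) s hs)
      (fun η => η 0 = Fin.last (R + 1)), hfil, hL, hR]
    have : A * P⁻¹ * Q⁻¹ * (A + B)⁻¹ + B * P⁻¹ * Q⁻¹ * (A + B)⁻¹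
        = P⁻¹ * Q⁻¹ * ((A + B) * (A + B)⁻¹) := by ring
    rw [this, mul_inv_cancel₀ hAB, mul_one]

end
end
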